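/- Let V be a finite-dimensional vector space and let γ₊ : Λ(V) → End(Λ(V)) be the left regular representation (creation operators) and γ₋ : Λ(V*) → End(Λ(V)) the action by annihilation operators dual to right multiplication. Then the linear map γ : Λ(V*) ⊗ Λ(V) → End(Λ(V)), y ⊗ x ↦ γ₋(y)γ₊(x), is a linear isomorphism. -/

import Mathlib

open ExteriorAlgebra Module

namespace ExteriorAlgebra

variable {K V : Type*} [Field K] [AddCommGroup V] [Module K V]

/-- The annihilation operator on the exterior algebra attached to a linear form. -/
noncomputable def annihilation (f : Dual K V) : Module.End K (ExteriorAlgebra K V) :=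
  CliffordAlgebra.contractLeft f

/-- The creation operators: left multiplication by vectors. -/
noncomputable def creation (v : V) : Module.End K (ExteriorAlgebra K V) :=
  LinearMap.mulLeft K (ι K v)

@[simp]
lemma creation_apply (v : V) (w : ExteriorAlgebra K V) : creation v w = ι K v * w := rfl

lemma annihilation_ι_mul (f : Dual K V) (v : V) (w : ExteriorAlgebra K V) :
    annihilation f (ι K v * w) = f v • w - ι K v * annihilation f w :=
  CliffordAlgebra.contractLeft_ι_mul f v w

@[simp]
lemma annihilation_algebraMap (f : Dual K V) (r : K) :
    annihilation f (algebraMap K (ExteriorAlgebra K V) r) = 0 :=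
  CliffordAlgebra.contractLeft_algebraMap 0 f r

@[simp]
lemma annihilation_one (f : Dual K V) : annihilation f (1 : ExteriorAlgebra K V) = 0 :=
  CliffordAlgebra.contractLeft_one 0 f

lemma creation_mul_annihilation (v : V) (f : Dual K V) :
    creation v * annihilation f = algebraMap K _ (f v) - annihilation f * creation v := by
  refine LinearMap.ext fun w => ?_
  simp [annihilation_ι_mul, Module.algebraMap_end_apply]

lemma annihilation_ofFn_prod (f : Dual K V) (k : ℕ) (v : Fin k → V) :
    annihilation f (List.ofFn fun i => ι K (v i)).prod =
      ∑ j : Fin k, ((-1 : K) ^ (j : ℕ) * f (v j)) •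
        ((List.ofFn fun i => ι K (v i)).eraseIdx j).prod := by
  induction k with
  | zero => simp
  | succ k ih =>
    rw [List.ofFn_succ, List.prod_cons, annihilation_ι_mul, ih, Fin.sum_univ_succ,
      Finset.mul_sum, sub_eq_add_neg, ← Finset.sum_neg_distrib]
    congr 1
    · simp
    · refine Finset.sum_congr rfl fun j _ => ?_
      simp [pow_succ]

/-- The increasing filtration of the exterior algebra by degree. -/
noncomputable def degreeLE (K V : Type*) [Field K] [AddCommGroup V] [Module K V] (k : ℕ) :
    Submodule K (ExteriorAlgebra K V) :=
  (1 ⊔ LinearMap.range (ι K)) ^ k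

lemma mem_degreeLE_zero {w : ExteriorAlgebra K V} :
    w ∈ degreeLE K V 0 ↔ ∃ r : K, algebraMap K _ r = w := by
  simp [degreeLE, Submodule.mem_one]

lemma degreeLE_le_succ (k : ℕ) : degreeLE K V k ≤ degreeLE K V (k + 1) :=
  pow_le_pow_right' (a := (1 ⊔ LinearMap.range (ι K) : Submodule K (ExteriorAlgebra K V)))
    le_sup_left k.le_succ

lemma ι_mul_mem_degreeLE {k : ℕ} (v : V) {w : ExteriorAlgebra K V} (hw : w ∈ degreeLE K V k) :
    ι K v * w ∈ degreeLE K V (k + 1) := by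
  rw [degreeLE, pow_succ']
  exact Submodule.mul_mem_mul (Submodule.mem_sup_right ⟨v, rfl⟩) hw

lemma degreeLE_succ_induction {k : ℕ} {P : Submodule K (ExteriorAlgebra K V)}
    (h₀ : degreeLE K V k ≤ P) (h₁ : ∀ v, ∀ w ∈ degreeLE K V k, ι K v * w ∈ P) :
    degreeLE K V (k + 1) ≤ P := by
  rw [degreeLE, pow_succ', Submodule.sup_mul, one_mul]
  refine sup_le h₀ (Submodule.mul_le.2 ?_)
  rintro _ ⟨v, rfl⟩ w hw
  exact h₁ v w hw

lemma exists_mem_degreeLE (w : ExteriorAlgebra K V) : ∃ k, w ∈ degreeLE K V k := by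
  have hmono : Monotone (degreeLE K V) := monotone_nat_of_le_succ degreeLE_le_succ
  induction w using ExteriorAlgebra.induction with
  | algebraMap r => exact ⟨0, mem_degreeLE_zero.2 ⟨r, rfl⟩⟩
  | ι v => exact ⟨1, by simpa using ι_mul_mem_degreeLE v (mem_degreeLE_zero.2 ⟨1, map_one _⟩)⟩
  | mul a b ha hb =>
    obtain ⟨i, hi⟩ := ha
    obtain ⟨j, hj⟩ := hb
    refine ⟨i + j, ?_⟩
    rw [degreeLE, pow_add]
    exact Submodule.mul_mem_mul hi hj
  | add a b ha hb =>
    obtain ⟨i, hi⟩ := ha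
    obtain ⟨j, hj⟩ := hb
    exact ⟨max i j, add_mem (hmono (le_max_left i j) hi) (hmono (le_max_right i j) hj)⟩

lemma annihilation_mem_degreeLE (f : Dual K V) (k : ℕ) {w : ExteriorAlgebra K V}
    (hw : w ∈ degreeLE K V (k + 1)) : annihilation f w ∈ degreeLE K V k := by
  induction k generalizing w with
  | zero =>
    refine degreeLE_succ_induction (P := (degreeLE K V 0).comap (annihilation f)) ?_ ?_ hw
    · intro z hz
      obtain ⟨r, rfl⟩ := mem_degreeLE_zero.1 hz
      simp
    · intro v z hz
      obtain ⟨r, rfl⟩ := mem_degreeLE_zero.1 hz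
      simpa [annihilation_ι_mul] using Submodule.smul_mem _ (f v) hz
  | succ k ih =>
    refine degreeLE_succ_induction (P := (degreeLE K V (k + 1)).comap (annihilation f)) ?_ ?_ hw
    · exact fun z hz => degreeLE_le_succ k (ih hz)
    · intro v z hz
      rw [Submodule.mem_comap, annihilation_ι_mul]
      exact sub_mem (Submodule.smul_mem _ _ hz) (ι_mul_mem_degreeLE v (ih hz))

section NumberOperator

variable {I : Type*} [Fintype I] (b : Basis I K V)

/-- The number operator, which acts on the `k`-th exterior power as multiplication by `k`. -/
noncomputable def numberOperator : Module.End K (ExteriorAlgebra K V) :=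
  ∑ i, creation (b i) * annihilation (b.coord i)

lemma numberOperator_apply (w : ExteriorAlgebra K V) :
    numberOperator b w = ∑ i, ι K (b i) * annihilation (b.coord i) w := by
  simp [numberOperator]

lemma numberOperator_ι_mul (v : V) (w : ExteriorAlgebra K V) :
    numberOperator b (ι K v * w) = ι K v * w + ι K v * numberOperator b w := by
  have hanti (i : I) : ι K (b i) * ι K v = -(ι K v * ι K (b i)) :=
    eq_neg_of_add_eq_zero_left (ι_add_mul_swap _ _)
  have hv : ι K v = ∑ i, b.coord i v • ι K (b i) := by
    conv_lhs => rw [← b.sum_repr v, map_sum]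
    simp only [map_smul, b.coord_apply]
  simp only [numberOperator_apply, annihilation_ι_mul, mul_sub, Finset.sum_sub_distrib,
    ← mul_assoc, hanti, Finset.mul_sum]
  conv_rhs => rw [hv, Finset.sum_mul]
  simp [hv]

lemma numberOperator_sub_mem_degreeLE (k : ℕ) {w : ExteriorAlgebra K V}
    (hw : w ∈ degreeLE K V (k + 1)) :
    numberOperator b w - ((k + 1 : ℕ) : K) • w ∈ degreeLE K V k := by
  have hmem {k : ℕ} {w : ExteriorAlgebra K V} (hw : w ∈ degreeLE K V (k + 1)) :
      numberOperator b w ∈ degreeLE K V (k + 1) := by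
    rw [numberOperator_apply]
    exact sum_mem fun i _ => ι_mul_mem_degreeLE _ (annihilation_mem_degreeLE _ _ hw)
  have hscalar {w : ExteriorAlgebra K V} (hw : w ∈ degreeLE K V 0) : numberOperator b w = 0 := by
    obtain ⟨r, rfl⟩ := mem_degreeLE_zero.1 hw
    simp [numberOperator_apply]
  induction k generalizing w with
  | zero =>
    refine degreeLE_succ_induction
      (P := (degreeLE K V 0).comap (numberOperator b - ((0 + 1 : ℕ) : K) • 1)) ?_ ?_ hw
    · intro z hz
      simpa [hscalar hz] using hz
    · intro v z hz
      simp [numberOperator_ι_mul, hscalar hz]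
  | succ k ih =>
    refine degreeLE_succ_induction
      (P := (degreeLE K V (k + 1)).comap (numberOperator b - ((k + 1 + 1 : ℕ) : K) • 1)) ?_ ?_ hw
    · intro z hz
      exact sub_mem (hmem hz) (Submodule.smul_mem _ _ hz)
    · intro v z hz
      change numberOperator b (ι K v * z) - ((k + 1 + 1 : ℕ) : K) • (ι K v * z) ∈
        degreeLE K V (k + 1)
      convert ι_mul_mem_degreeLE v (ih hz) using 1
      simp only [numberOperator_ι_mul, mul_sub, mul_smul_comm]
      push_cast
      module

end NumberOperator

/-- An element killed by all annihilation operators is a scalar. -/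
lemma mem_degreeLE_zero_of_annihilation_eq_zero [CharZero K] [FiniteDimensional K V]
    {w : ExteriorAlgebra K V} (hw : ∀ f : Dual K V, annihilation f w = 0) :
    w ∈ degreeLE K V 0 := by
  obtain ⟨k, hk⟩ := exists_mem_degreeLE w
  induction k with
  | zero => exact hk
  | succ k ih =>
    apply ih
    have h := numberOperator_sub_mem_degreeLE (finBasis K V) k hk
    rw [numberOperator_apply] at h
    simp only [hw, mul_zero, Finset.sum_const_zero, zero_sub, neg_mem_iff] at h
    exact (Submodule.smul_mem_iff _ (Nat.cast_ne_zero.2 k.succ_ne_zero)).1 h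

/-- A nonzero subspace stable under all annihilation operators contains the vacuum vector. -/
lemma one_mem_of_annihilation_mem [CharZero K] [FiniteDimensional K V]
    {N : Submodule K (ExteriorAlgebra K V)}
    (hN : ∀ (f : Dual K V), ∀ w ∈ N, annihilation f w ∈ N) {w : ExteriorAlgebra K V}
    (hw : w ∈ N) (hw₀ : w ≠ 0) : 1 ∈ N := by
  have hscalar {w : ExteriorAlgebra K V} (hw : w ∈ N) (hw₀ : w ≠ 0) (h : w ∈ degreeLE K V 0) :
      1 ∈ N := by
    obtain ⟨r, rfl⟩ := mem_degreeLE_zero.1 h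
    have hr : r ≠ 0 := by
      rintro rfl
      simp at hw₀
    rwa [Algebra.algebraMap_eq_smul_one, Submodule.smul_mem_iff _ hr] at hw
  obtain ⟨k, hk⟩ := exists_mem_degreeLE w
  induction k generalizing w with
  | zero => exact hscalar hw hw₀ hk
  | succ k ih =>
    by_cases h : ∀ f : Dual K V, annihilation f w = 0
    · exact hscalar hw hw₀ (mem_degreeLE_zero_of_annihilation_eq_zero h)
    · push Not at h
      obtain ⟨f, hf⟩ := h
      exact ih (hN f w hw) hf (annihilation_mem_degreeLE f k hk)

instance instFiniteDimensional [FiniteDimensional K V] :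
    FiniteDimensional K (ExteriorAlgebra K V) :=
  (finBasis K V).ExteriorAlgebra.finiteDimensional_of_finite

lemma finrank_dual [FiniteDimensional K V] :
    finrank K (ExteriorAlgebra K (Dual K V)) = finrank K (ExteriorAlgebra K V) := by
  let b := finBasis K V
  rw [finrank_eq_card_basis b.ExteriorAlgebra, finrank_eq_card_basis b.dualBasis.ExteriorAlgebra]

/-- There is a nonzero element of top degree. -/
lemma exists_ne_zero_mul_ι_eq_zero [FiniteDimensional K V] :
    ∃ t : ExteriorAlgebra K V, t ≠ 0 ∧ ∀ v : V, t * ι K v = 0 := by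
  have htop : ⋀[K]^(finrank K V) V ≠ ⊥ := by
    intro h
    have := exteriorPower.finrank_eq (R := K) (M := V) (n := finrank K V)
    rw [Submodule.finrank_eq_zero.2 h, Nat.choose_self] at this
    exact zero_ne_one this
  have hbot : ⋀[K]^(finrank K V + 1) V = ⊥ := by
    rw [← Submodule.finrank_eq_zero, exteriorPower.finrank_eq, Nat.choose_succ_self]
  obtain ⟨t, ht, ht₀⟩ := Submodule.exists_mem_ne_zero_of_ne_bot htop
  refine ⟨t, ht₀, fun v => ?_⟩
  have : t * ι K v ∈ ⋀[K]^(finrank K V + 1) V := by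
    rw [exteriorPower, pow_succ]
    exact Submodule.mul_mem_mul ht ⟨v, rfl⟩
  simpa [hbot] using this

lemma mul_eq_algebraMapInv_smul {t : ExteriorAlgebra K V} (ht : ∀ v : V, t * ι K v = 0)
    (w : ExteriorAlgebra K V) : t * w = algebraMapInv w • t := by
  induction w using ExteriorAlgebra.induction with
  | algebraMap r => simp [← Algebra.commutes, Algebra.smul_def]
  | ι v => simp [ht, algebraMapInv]
  | mul a b ha hb => rw [← mul_assoc, ha, smul_mul_assoc, hb, map_mul, mul_smul]
  | add a b ha hb => rw [mul_add, ha, hb, map_add, add_smul]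

lemma mulLeft_mem {A : Subalgebra K (Module.End K (ExteriorAlgebra K V))}
    (hA : ∀ v, creation v ∈ A) (a : ExteriorAlgebra K V) : LinearMap.mulLeft K a ∈ A := by
  have h : (⊤ : Subalgebra K (ExteriorAlgebra K V)) ≤ A.comap (Algebra.lmul K _) := by
    intro a _
    induction a using ExteriorAlgebra.induction with
    | algebraMap r => exact algebraMap_mem _ r
    | ι v => exact hA v
    | mul a b ha hb => exact mul_mem (ha trivial) (hb trivial)
    | add a b ha hb => exact add_mem (ha trivial) (hb trivial)
  exact h (Algebra.mem_top (x := a))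

/-- Creation and annihilation operators generate all endomorphisms of the exterior algebra. -/
lemma eq_top_of_creation_mem_of_annihilation_mem [CharZero K] [FiniteDimensional K V]
    {A : Subalgebra K (Module.End K (ExteriorAlgebra K V))}
    (hcre : ∀ v, creation v ∈ A) (hann : ∀ f, annihilation f ∈ A) : A = ⊤ := by
  let ε : Dual K (ExteriorAlgebra K V) := algebraMapInv.toLinearMap
  let N : Submodule K (ExteriorAlgebra K V) :=
    A.toSubmodule.comap (LinearMap.smulRightₗ ε)
  have hN {x : ExteriorAlgebra K V} : x ∈ N ↔ ε.smulRight x ∈ A := Iff.rfl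
  have hNA {a : Module.End K (ExteriorAlgebra K V)} (ha : a ∈ A) {x} (hx : x ∈ N) : a x ∈ N := by
    rw [hN] at hx ⊢
    convert mul_mem ha hx using 1
    refine LinearMap.ext fun w => ?_
    simp
  have hone : 1 ∈ N := by
    obtain ⟨t, ht₀, ht⟩ := exists_ne_zero_mul_ι_eq_zero (K := K) (V := V)
    refine one_mem_of_annihilation_mem (fun f w => hNA (hann f)) (w := t) ?_ ht₀
    rw [hN]
    convert mulLeft_mem hcre t using 1
    refine LinearMap.ext fun w => ?_
    exact (mul_eq_algebraMapInv_smul ht w).symm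
  have hNtop (x : ExteriorAlgebra K V) : ε.smulRight x ∈ A := by
    simpa using hN.1 (hNA (mulLeft_mem hcre x) hone)
  let Φ : Submodule K (Dual K (ExteriorAlgebra K V)) :=
    ⨅ x, A.toSubmodule.comap ((LinearMap.smulRightₗ (R := K)).flip x)
  have hΦ {φ : Dual K (ExteriorAlgebra K V)} : φ ∈ Φ ↔ ∀ x, φ.smulRight x ∈ A := by
    simp only [Φ, Submodule.mem_iInf]
    rfl
  have hΦbot : Φ.dualCoannihilator = ⊥ := by
    by_contra hne
    obtain ⟨w, hw, hw₀⟩ := Submodule.exists_mem_ne_zero_of_ne_bot hne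
    have h1 : 1 ∈ Φ.dualCoannihilator := by
      refine one_mem_of_annihilation_mem (fun f w hw => ?_) hw hw₀
      rw [Submodule.mem_dualCoannihilator] at hw ⊢
      exact fun φ hφ => hw (φ ∘ₗ annihilation f)
        (hΦ.2 fun x => mul_mem (hΦ.1 hφ x) (hann f))
    have := (Submodule.mem_dualCoannihilator _).1 h1 ε (hΦ.2 hNtop)
    simp [ε] at this
  have hΦtop : Φ = ⊤ := by
    rw [← Subspace.dualCoannihilator_dualAnnihilator_eq (W := Φ), hΦbot,
      Submodule.dualAnnihilator_bot]
  refine Algebra.eq_top_iff.2 fun T => ?_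
  let b := finBasis K (ExteriorAlgebra K V)
  have hT : T = ∑ i, (b.coord i).smulRight (T (b i)) := by
    refine b.ext fun j => ?_
    simp [Finsupp.single_apply]
  rw [hT]
  exact sum_mem fun i _ => hΦ.1 (hΦtop ▸ Submodule.mem_top) _

/-- Normal ordering: products of annihilation operators followed by creation operators exhaust
all endomorphisms. -/
lemma lift_mul_surjective [CharZero K] [FiniteDimensional K V]
    (γplus : ExteriorAlgebra K V →ₐ[K] Module.End K (ExteriorAlgebra K V))
    (hplus : ∀ v, γplus (ι K v) = creation v)
    (γminus : ExteriorAlgebra K (Dual K V) →ₐ[K] Module.End K (ExteriorAlgebra K V))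
    (hminus : ∀ f, γminus (ι K f) = annihilation f) :
    Function.Surjective (TensorProduct.lift
      ((LinearMap.mul K (Module.End K (ExteriorAlgebra K V))).compl₁₂
        γminus.toLinearMap γplus.toLinearMap)) := by
  set γ := TensorProduct.lift
      ((LinearMap.mul K (Module.End K (ExteriorAlgebra K V))).compl₁₂
        γminus.toLinearMap γplus.toLinearMap) with hγ
  let R := LinearMap.range γ
  have hmem (y x) : γminus y * γplus x ∈ R := ⟨TensorProduct.tmul K y x, by simp [hγ]⟩
  have hind {L : Module.End K (ExteriorAlgebra K V)}
      (h : ∀ y x, L * (γminus y * γplus x) ∈ R) {T} (hT : T ∈ R) : L * T ∈ R := by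
    obtain ⟨z, rfl⟩ := hT
    induction z with
    | zero => simp
    | tmul y x => simpa [hγ] using h y x
    | add z₁ z₂ h₁ h₂ =>
      rw [map_add, mul_add]
      exact add_mem h₁ h₂
  have hminus_mul (y) {T} (hT : T ∈ R) : γminus y * T ∈ R :=
    hind (fun y' x => by simpa [mul_assoc] using hmem (y * y') x) hT
  have hcre (v : V) {T} (hT : T ∈ R) : creation v * T ∈ R := by
    refine hind (fun y x => ?_) hT
    clear hT T
    induction y using CliffordAlgebra.left_induction with
    | algebraMap r =>
      rw [AlgHom.commutes, ← mul_assoc, ← Algebra.commutes, mul_assoc, ← hplus, ← map_mul,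
        ← AlgHom.commutes γminus]
      exact hmem _ _
    | add y₁ y₂ h₁ h₂ =>
      rw [map_add, add_mul, mul_add]
      exact add_mem h₁ h₂
    | ι_mul y f h =>
      have hf : γminus (CliffordAlgebra.ι 0 f) = annihilation f := hminus f
      rw [map_mul, hf, mul_assoc, ← mul_assoc, creation_mul_annihilation, sub_mul, ← hf]
      refine sub_mem ?_ ?_
      · rw [← Algebra.smul_def]
        exact R.smul_mem _ (hmem _ _)
      · rw [mul_assoc]
        exact hminus_mul _ h
  let A : Subalgebra K (Module.End K (ExteriorAlgebra K V)) :=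
    { carrier := {L | ∀ T ∈ R, L * T ∈ R}
      mul_mem' := fun {a b} ha hb T hT => by
        rw [mul_assoc]
        exact ha _ (hb _ hT)
      add_mem' := fun {a b} ha hb T hT => by
        rw [add_mul]
        exact add_mem (ha _ hT) (hb _ hT)
      algebraMap_mem' := fun r T hT => by
        rw [← Algebra.smul_def]
        exact R.smul_mem r hT }
  have hA : A = ⊤ := eq_top_of_creation_mem_of_annihilation_mem
    (fun v T hT => hcre v hT) (fun f T hT => hminus f ▸ hminus_mul _ hT)
  intro T
  have hT : T ∈ A := hA ▸ Algebra.mem_top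
  simpa [R] using hT 1 (by simpa using hmem 1 1)

end ExteriorAlgebra



/-- Let `γ₊ : Λ(V) → End(Λ(V))` be the left regular representation (creation operators) and
`γ₋ : Λ(V*) → End(Λ(V))` the algebra homomorphism generated by the annihilation operators
`δ_f (v₁ ∧ ⋯ ∧ v_k) = Σ_j (−1)^{j−1} f(v_j) v₁ ∧ ⋯ ∧ v̂_j ∧ ⋯ ∧ v_k`.  Then the linear map
`γ : Λ(V*) ⊗ Λ(V) → End(Λ(V))`, `y ⊗ x ↦ γ₋(y) γ₊(x)`, is a linear isomorphism. -/
theorem stmt_13 (V : Type*) [AddCommGroup V] [Module ℂ V] [FiniteDimensional ℂ V]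
    (γplus : ExteriorAlgebra ℂ V →ₐ[ℂ] Module.End ℂ (ExteriorAlgebra ℂ V))
    (hγplus : ∀ a b : ExteriorAlgebra ℂ V, γplus a b = a * b)
    (γminus : ExteriorAlgebra ℂ (Module.Dual ℂ V) →ₐ[ℂ]
      Module.End ℂ (ExteriorAlgebra ℂ V))
    (hγminus : ∀ (f : Module.Dual ℂ V) (k : ℕ) (v : Fin k → V),
      γminus (ι ℂ f) ((List.ofFn fun i => ι ℂ (v i)).prod) =
        ∑ j : Fin k, ((-1 : ℂ) ^ (j : ℕ) * f (v j)) •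
          ((List.ofFn fun i => ι ℂ (v i)).eraseIdx j).prod) :
    Function.Bijective
      (TensorProduct.lift
        ((LinearMap.mul ℂ (Module.End ℂ (ExteriorAlgebra ℂ V))).compl₁₂
          γminus.toLinearMap γplus.toLinearMap)) := by
  have hplus (v : V) : γplus (ι ℂ v) = creation v := LinearMap.ext fun w => hγplus _ w
  have hminus (f : Dual ℂ V) : γminus (ι ℂ f) = annihilation f := by
    refine LinearMap.ext_on (ιMulti_span ℂ V) ?_
    rintro _ ⟨⟨k, v⟩, rfl⟩
    exact (hγminus f k v).trans (annihilation_ofFn_prod f k v).symm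
  have hsurj := lift_mul_surjective γplus hplus γminus hminus
  refine ⟨(LinearMap.injective_iff_surjective_of_finrank_eq_finrank ?_).2 hsurj, hsurj⟩
  rw [finrank_tensorProduct, finrank_linearMap, finrank_dual]
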